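/- arXiv:1509.08571 — 2 statements merged into one kernel-verified Lean document; each statement's English description precedes it below -/
import Mathlib

section
/- Let 𝒯_A be surjective. Then the supremum of values Alice can strongly guarantee equals the supremum of values she can weakly guarantee, and both equal min_{s_A ∈ 𝒮_A} inf { u(q) : q a probability distribution on 𝒮 with support(q) ⊆ 𝒯_A^{-1}(s_A) }. That is, v_sup^s(p, 𝒯_A, 𝒯_B) = v_sup^w(p, 𝒯_A, 𝒯_B) = min_{s_A} min_{q : support(q) ⊆ 𝒯_A^{-1}(s_A)} u(q). -/
open Finset

/-- A behavioral strategy in the `n`-stage repeated game: at stage `i`, given the history of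
past actions of both players (only the first `i` coordinates of the supplied sequences matter,
as enforced by `causal`) and the player's side information `si`, it assigns a probability to
each action `x`. -/
structure BehavStrategy (A B SI Act : Type*) [Fintype A] [Fintype B] [Fintype Act] (n : ℕ) where
  prob : Fin n → (Fin n → A) → (Fin n → B) → SI → Act → ℝ
  nonneg : ∀ i ha hb si x, 0 ≤ prob i ha hb si x
  sum_one : ∀ i ha hb si, ∑ x, prob i ha hb si x = 1
  causal : ∀ (i : Fin n) (ha ha' : Fin n → A) (hb hb' : Fin n → B) (si : SI),
    (∀ j : Fin n, (j : ℕ) < (i : ℕ) → ha j = ha' j) →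
    (∀ j : Fin n, (j : ℕ) < (i : ℕ) → hb j = hb' j) →
    prob i ha hb si = prob i ha' hb' si

variable {S SA SB A B : Type*} [Fintype S] [Fintype A] [Fintype B]

/-- The probability that the state is `s` and the action sequences are `a, b`, under prior `p`,
side-information maps `TA, TB`, and behavioral strategies `α` (Alice) and `β` (Bob). -/
noncomputable def inducedP (p : S → ℝ) (TA : S → SA) (TB : S → SB) {n : ℕ}
    (α : BehavStrategy A B SA A n) (β : BehavStrategy A B SB B n)
    (s : S) (a : Fin n → A) (b : Fin n → B) : ℝ :=
  p s * ∏ i, (α.prob i a b (TA s) (a i) * β.prob i a b (TB s) (b i))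

/-- Alice's time-average payoff `σ_n`. -/
noncomputable def avgPay (g : S → A → B → ℝ) {n : ℕ} (s : S) (a : Fin n → A) (b : Fin n → B) : ℝ :=
  (n : ℝ)⁻¹ * ∑ i, g s (a i) (b i)

open scoped Classical in
/-- `P(σ_n < v)` under the induced distribution. -/
noncomputable def probBelow (g : S → A → B → ℝ) (p : S → ℝ) (TA : S → SA) (TB : S → SB)
    {n : ℕ} (α : BehavStrategy A B SA A n) (β : BehavStrategy A B SB B n) (v : ℝ) : ℝ :=
  ∑ s : S, ∑ a : Fin n → A, ∑ b : Fin n → B,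
    if avgPay g s a b < v then inducedP p TA TB α β s a b else 0

/-- Alice strongly guarantees `v`. -/
def StronglyGuarantees (g : S → A → B → ℝ) (p : S → ℝ) (TA : S → SA) (TB : S → SB)
    (v : ℝ) : Prop :=
  ∀ ε : ℝ, 0 < ε → ∃ N : ℕ, ∀ n : ℕ, N < n → ∃ α : BehavStrategy A B SA A n,
    ∀ β : BehavStrategy A B SB B n, probBelow g p TA TB α β v < ε

/-- Alice weakly guarantees `v`. -/
def WeaklyGuarantees (g : S → A → B → ℝ) (p : S → ℝ) (TA : S → SA) (TB : S → SB)
    (v : ℝ) : Prop :=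
  ∀ ε : ℝ, 0 < ε → ∃ N : ℕ, ∀ n : ℕ, N < n → ∀ β : BehavStrategy A B SB B n,
    ∃ α : BehavStrategy A B SA A n, probBelow g p TA TB α β v < ε

/-- `v_sup^s`, the supremum of strongly guaranteeable values. -/
noncomputable def vsupS (g : S → A → B → ℝ) (p : S → ℝ) (TA : S → SA) (TB : S → SB) : ℝ :=
  sSup {v : ℝ | StronglyGuarantees g p TA TB v}

/-- `v_sup^w`, the supremum of weakly guaranteeable values. -/
noncomputable def vsupW (g : S → A → B → ℝ) (p : S → ℝ) (TA : S → SA) (TB : S → SB) : ℝ :=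
  sSup {v : ℝ | WeaklyGuarantees g p TA TB v}

/-- `u(q)`: the value of the one-stage game with averaged payoff table `∑ s, q s • g s`. -/
noncomputable def uVal (g : S → A → B → ℝ) (q : S → ℝ) : ℝ :=
  ⨆ x : {x : A → ℝ // (∀ a, 0 ≤ x a) ∧ ∑ a, x a = 1},
    ⨅ b : B, ∑ s : S, ∑ a : A, q s * x.1 a * g s a b

/-- Expected time-average payoff `E[σ_n]`. -/
noncomputable def expPay (g : S → A → B → ℝ) (p : S → ℝ) (TA : S → SA) (TB : S → SB)
    {n : ℕ} (α : BehavStrategy A B SA A n) (β : BehavStrategy A B SB B n) : ℝ :=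
  ∑ s : S, ∑ a : Fin n → A, ∑ b : Fin n → B,
    inducedP p TA TB α β s a b * avgPay g s a b

/-- `V_n(q)`: the maximin expected average payoff of the `n`-stage game with prior `q`,
no side information for Alice and full information for Bob. -/
noncomputable def Vn (g : S → A → B → ℝ) (q : S → ℝ) (n : ℕ) : ℝ :=
  ⨆ α : BehavStrategy A B Unit A n, ⨅ β : BehavStrategy A B S B n,
    expPay g q (fun _ => ()) (id : S → S) α β

/-- The strategy on the remaining `n` stages once the first stage was played as `(a₀, b₀)`. -/
def BehavStrategy.tail {SI Act : Type*} [Fintype Act] {n : ℕ}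
    (σ : BehavStrategy A B SI Act (n + 1)) (a₀ : A) (b₀ : B) : BehavStrategy A B SI Act n where
  prob i ha hb := σ.prob i.succ (Fin.cons a₀ ha) (Fin.cons b₀ hb)
  nonneg _ _ _ := σ.nonneg _ _ _
  sum_one _ _ _ := σ.sum_one _ _ _
  causal i ha ha' hb hb' si hab hbb := by
    refine σ.causal _ _ _ _ _ si ?_ ?_ <;> refine Fin.cases (fun _ => rfl) fun j hj => ?_
    · simpa using hab j (by simpa using hj)
    · simpa using hbb j (by simpa using hj)

theorem BehavStrategy.prob_zero_eq {SI Act : Type*} [Fintype Act] {n : ℕ}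
    (σ : BehavStrategy A B SI Act (n + 1)) (ha ha' : Fin (n + 1) → A) (hb hb' : Fin (n + 1) → B)
    (si : SI) : σ.prob 0 ha hb si = σ.prob 0 ha' hb' si :=
  σ.causal _ _ _ _ _ _ (by simp) (by simp)

/-- The probability of the action sequences `a, b` given both side informations. -/
noncomputable def playProb {n : ℕ} (α : BehavStrategy A B SA A n) (β : BehavStrategy A B SB B n)
    (si : SA) (sj : SB) (a : Fin n → A) (b : Fin n → B) : ℝ :=
  ∏ i, (α.prob i a b si (a i) * β.prob i a b sj (b i))

theorem playProb_nonneg {n : ℕ} (α : BehavStrategy A B SA A n) (β : BehavStrategy A B SB B n)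
    (si : SA) (sj : SB) (a : Fin n → A) (b : Fin n → B) : 0 ≤ playProb α β si sj a b :=
  prod_nonneg fun _ _ => mul_nonneg (α.nonneg ..) (β.nonneg ..)

/-- The sum of `d` over the stages preceding stage `i`. -/
def partialSum {E : Type*} [AddCommMonoid E] (d : A → B → E) {n : ℕ} (i : Fin n)
    (a : Fin n → A) (b : Fin n → B) : E :=
  ∑ j, if j < i then d (a j) (b j) else 0

theorem sum_fin_succ_pi {C : Type*} [Fintype C] {n : ℕ} (f : (Fin (n + 1) → C) → ℝ) :
    ∑ c, f c = ∑ c₀ : C, ∑ c : Fin n → C, f (Fin.cons c₀ c) := by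
  rw [← Fintype.sum_prod_type']
  exact (Equiv.sum_comp (Fin.consEquiv fun _ => C) f).symm

theorem sum_playProb_succ {n : ℕ} (α : BehavStrategy A B SA A (n + 1))
    (β : BehavStrategy A B SB B (n + 1)) (si : SA) (sj : SB) (ha : Fin (n + 1) → A)
    (hb : Fin (n + 1) → B) (f : (Fin (n + 1) → A) → (Fin (n + 1) → B) → ℝ) :
    ∑ a, ∑ b, playProb α β si sj a b * f a b =
      ∑ a₀, ∑ b₀, α.prob 0 ha hb si a₀ * β.prob 0 ha hb sj b₀ *
        ∑ a, ∑ b, playProb (α.tail a₀ b₀) (β.tail a₀ b₀) si sj a b *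
          f (Fin.cons a₀ a) (Fin.cons b₀ b) := by
  rw [sum_fin_succ_pi]
  refine sum_congr rfl fun a₀ _ => ?_
  simp_rw [sum_fin_succ_pi (C := B)]
  rw [sum_comm]
  refine sum_congr rfl fun b₀ _ => ?_
  simp_rw [mul_sum]
  refine sum_congr rfl fun a _ => sum_congr rfl fun b _ => ?_
  simp only [playProb, Fin.prod_univ_succ, Fin.cons_zero, Fin.cons_succ, BehavStrategy.tail]
  rw [α.prob_zero_eq _ ha _ hb, β.prob_zero_eq _ ha _ hb]
  ring

/-- If a potential drifts up by at most `C` at each stage in expectation, then it drifts up by at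
most `n * C` over the whole play. -/
theorem sum_playProb_potential_le {E : Type*} [AddCommMonoid E] [Nonempty A] [Nonempty B]
    (d : A → B → E) (Φ : E → ℝ) (C : ℝ) {n : ℕ} (α : BehavStrategy A B SA A n)
    (β : BehavStrategy A B SB B n) (si : SA) (sj : SB) (x₀ : E)
    (hstep : ∀ i a b, ∑ a', ∑ b', α.prob i a b si a' * β.prob i a b sj b' *
      Φ (x₀ + partialSum d i a b + d a' b') ≤ Φ (x₀ + partialSum d i a b) + C) :
    ∑ a, ∑ b, playProb α β si sj a b * Φ (x₀ + ∑ i, d (a i) (b i)) ≤ Φ x₀ + n * C := by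
  induction n generalizing x₀ with
  | zero => simp [playProb]
  | succ n ih =>
    let ha : Fin (n + 1) → A := fun _ => Classical.arbitrary A
    let hb : Fin (n + 1) → B := fun _ => Classical.arbitrary B
    rw [sum_playProb_succ α β si sj ha hb]
    have h0 := hstep 0 ha hb
    simp only [partialSum, Fin.not_lt_zero, if_false, sum_const_zero, add_zero] at h0
    have key : ∀ a₀ b₀, ∑ a, ∑ b, playProb (α.tail a₀ b₀) (β.tail a₀ b₀) si sj a b *
        Φ (x₀ + ∑ i, d ((Fin.cons a₀ a : Fin (n + 1) → A) i)
          ((Fin.cons b₀ b : Fin (n + 1) → B) i)) ≤ Φ (x₀ + d a₀ b₀) + n * C := by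
      intro a₀ b₀
      have := ih (α.tail a₀ b₀) (β.tail a₀ b₀) (x₀ + d a₀ b₀) fun i a b => by
        have := hstep i.succ (Fin.cons a₀ a) (Fin.cons b₀ b)
        simpa [partialSum, Fin.sum_univ_succ, BehavStrategy.tail, add_assoc] using this
      simpa [Fin.sum_univ_succ, add_assoc] using this
    calc _ ≤ ∑ a₀, ∑ b₀, α.prob 0 ha hb si a₀ * β.prob 0 ha hb sj b₀ *
          (Φ (x₀ + d a₀ b₀) + n * C) :=
          sum_le_sum fun a₀ _ => sum_le_sum fun b₀ _ =>
            mul_le_mul_of_nonneg_left (key a₀ b₀) (mul_nonneg (α.nonneg ..) (β.nonneg ..))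
      _ = (∑ a₀, ∑ b₀, α.prob 0 ha hb si a₀ * β.prob 0 ha hb sj b₀ * Φ (x₀ + d a₀ b₀))
          + n * C := by
          simp_rw [mul_add, sum_add_distrib, ← sum_mul, ← mul_sum, β.sum_one, mul_one, α.sum_one,
            one_mul]
      _ ≤ _ := by push_cast; linarith

theorem sum_playProb [Nonempty A] [Nonempty B] {n : ℕ} (α : BehavStrategy A B SA A n)
    (β : BehavStrategy A B SB B n) (si : SA) (sj : SB) :
    ∑ a, ∑ b, playProb α β si sj a b = 1 := by
  have h (c : ℝ) := sum_playProb_potential_le (fun _ _ => (0 : ℝ)) (fun _ => c) 0 α β si sj 0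
    fun i a b => by simp_rw [← sum_mul, ← mul_sum, β.sum_one, mul_one, α.sum_one]; simp
  simp_rw [← sum_mul] at h
  linarith [h 1, h (-1)]

/-- The minimax theorem for matrix games. -/
theorem exists_matrixGame_saddle [Nonempty A] [Nonempty B] (h : A → B → ℝ) :
    ∃ x ∈ stdSimplex ℝ A, ∃ y ∈ stdSimplex ℝ B,
      ∀ a b, ∑ b', y b' * h a b' ≤ ∑ a', x a' * h a' b := by
  classical
  obtain ⟨y, hy, x, hx, hyx⟩ := Sion.exists_isSaddlePointOn (X := stdSimplex ℝ B)
    (Y := stdSimplex ℝ A) (f := fun y x => ∑ a, ∑ b, x a * y b * h a b)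
    ⟨_, single_mem_stdSimplex ℝ (Classical.arbitrary B)⟩ (convex_stdSimplex ℝ B)
    (isCompact_stdSimplex ℝ B)
    (fun x _ => (Continuous.continuousOn (by fun_prop)).lowerSemicontinuousOn)
    (fun x _ => ConvexOn.quasiconvexOn ⟨convex_stdSimplex ℝ B, fun y _ z _ s t _ _ _ => by
      simp only [Pi.add_apply, Pi.smul_apply, smul_eq_mul, mul_sum, ← sum_add_distrib]
      exact (sum_congr rfl fun a _ => sum_congr rfl fun b _ => by ring).le⟩)
    (convex_stdSimplex ℝ A) ⟨_, single_mem_stdSimplex ℝ (Classical.arbitrary A)⟩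
    (isCompact_stdSimplex ℝ A)
    (fun x _ => (Continuous.continuousOn (by fun_prop)).upperSemicontinuousOn)
    (fun x _ => ConcaveOn.quasiconcaveOn ⟨convex_stdSimplex ℝ A, fun y _ z _ s t _ _ _ => by
      simp only [Pi.add_apply, Pi.smul_apply, smul_eq_mul, mul_sum, ← sum_add_distrib]
      exact (sum_congr rfl fun a _ => sum_congr rfl fun b _ => by ring).le⟩)
  refine ⟨x, hx, y, hy, fun a b => ?_⟩
  simpa [Pi.single_apply] using
    hyx _ (single_mem_stdSimplex ℝ b) _ (single_mem_stdSimplex ℝ a)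

theorem exists_payoff_bound (g : S → A → B → ℝ) : ∃ M, 0 ≤ M ∧ ∀ s a b, |g s a b| ≤ M :=
  ⟨∑ x : S × A × B, |g x.1 x.2.1 x.2.2|, by positivity, fun s a b =>
    single_le_sum (f := fun x : S × A × B => |g x.1 x.2.1 x.2.2|) (fun _ _ => abs_nonneg _)
      (mem_univ (s, a, b))⟩

omit [Fintype B] in
theorem abs_mixed_payoff_le {g : S → A → B → ℝ} {M : ℝ} (hM : ∀ s a b, |g s a b| ≤ M)
    {q : S → ℝ} (hq : q ∈ stdSimplex ℝ S) {x : A → ℝ} (hx : x ∈ stdSimplex ℝ A) (b : B) :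
    |∑ s, ∑ a, q s * x a * g s a b| ≤ M :=
  calc _ ≤ ∑ s, ∑ a, |q s * x a * g s a b| :=
        (abs_sum_le_sum_abs _ _).trans (sum_le_sum fun _ _ => abs_sum_le_sum_abs _ _)
    _ ≤ ∑ s, ∑ a, q s * x a * M := sum_le_sum fun s _ => sum_le_sum fun a _ => by
        rw [abs_mul, abs_of_nonneg (mul_nonneg (hq.1 s) (hx.1 a))]
        exact mul_le_mul_of_nonneg_left (hM s a b) (mul_nonneg (hq.1 s) (hx.1 a))
    _ = M := by simp_rw [← sum_mul, ← mul_sum, hx.2, mul_one, hq.2, one_mul]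

theorem iInf_le_uVal [Nonempty B] (g : S → A → B → ℝ) {q : S → ℝ} (hq : q ∈ stdSimplex ℝ S)
    {x : A → ℝ} (hx : x ∈ stdSimplex ℝ A) :
    ⨅ b, ∑ s, ∑ a, q s * x a * g s a b ≤ uVal g q := by
  obtain ⟨M, -, hM⟩ := exists_payoff_bound g
  refine le_ciSup (f := fun x : {x : A → ℝ // (∀ a, 0 ≤ x a) ∧ ∑ a, x a = 1} =>
    ⨅ b, ∑ s, ∑ a, q s * x.1 a * g s a b) ⟨M, ?_⟩ ⟨x, hx⟩
  rintro _ ⟨x, rfl⟩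
  exact (ciInf_le (Set.finite_range _).bddBelow (Classical.arbitrary B)).trans
    (abs_le.1 (abs_mixed_payoff_le hM hq x.2 _)).2

theorem probBelow_eq (g : S → A → B → ℝ) (p : S → ℝ) (TA : S → SA) (TB : S → SB) {n : ℕ}
    (α : BehavStrategy A B SA A n) (β : BehavStrategy A B SB B n) (v : ℝ) :
    probBelow g p TA TB α β v = ∑ s, p s * ∑ a, ∑ b,
      Set.indicator {c : (Fin n → A) × (Fin n → B) | avgPay g s c.1 c.2 < v}
        (fun c => playProb α β (TA s) (TB s) c.1 c.2) (a, b) := by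
  simp only [probBelow, mul_sum, Set.indicator_apply, Set.mem_ofPred_eq, mul_ite, mul_zero]
  rfl

theorem sum_mixed_const_add {x : A → ℝ} (hx : x ∈ stdSimplex ℝ A) {y : B → ℝ}
    (hy : y ∈ stdSimplex ℝ B) (c : ℝ) (f : A → B → ℝ) :
    ∑ a, ∑ b, x a * y b * (c + f a b) = c + ∑ a, x a * ∑ b, y b * f a b := by
  simp_rw [mul_add, sum_add_distrib, mul_assoc, ← mul_sum, ← sum_mul, hy.2, hx.2, one_mul]

/-- The strategy drawing each action independently from the mixed action `y`. -/
def BehavStrategy.const {SI Act : Type*} [Fintype Act] (n : ℕ) (y : Act → ℝ)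
    (hy : y ∈ stdSimplex ℝ Act) : BehavStrategy A B SI Act n where
  prob _ _ _ _ := y
  nonneg _ _ _ _ := hy.1
  sum_one _ _ _ _ := hy.2
  causal _ _ _ _ _ _ _ _ := rfl

/-- Against an i.i.d. strategy of Bob that is optimal in the average game of `q`, Alice's
probability of staying below a value exceeding `u(q)` is bounded away from zero. -/
theorem le_uVal_of_weaklyGuarantees [Nonempty A] [Nonempty B] {g : S → A → B → ℝ} {p : S → ℝ}
    (hp : ∀ s, 0 < p s) {TA : S → SA} {TB : S → SB} {v : ℝ}
    (hv : WeaklyGuarantees g p TA TB v) {q : S → ℝ} (hq : q ∈ stdSimplex ℝ S) {sA : SA}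
    (hsupp : ∀ s, q s ≠ 0 → TA s = sA) : v ≤ uVal g q := by
  by_contra! hlt
  obtain ⟨M, hM0, hM⟩ := exists_payoff_bound g
  obtain ⟨x, hx, y, hy, hxy⟩ := exists_matrixGame_saddle fun a b => ∑ s, q s * g s a b
  have hyu (a : A) : ∑ b, y b * ∑ s, q s * g s a b ≤ uVal g q := by
    refine (le_ciInf fun b => (hxy a b).trans ?_).trans (iInf_le_uVal g hq hx)
    simp_rw [mul_sum]
    rw [sum_comm]
    exact (sum_congr rfl fun _ _ => sum_congr rfl fun _ _ => by ring).le
  obtain ⟨s₀, -, hs₀⟩ : ∃ s ∈ univ, q s ≠ 0 := exists_ne_zero_of_sum_ne_zero (by simp [hq.2])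
  set c := ∑ s, (p s)⁻¹
  have hcp (s : S) : 1 ≤ c * p s := by
    rw [← inv_mul_cancel₀ (hp s).ne']
    exact mul_le_mul_of_nonneg_right
      (single_le_sum (f := fun s => (p s)⁻¹) (fun s _ => (inv_pos.2 (hp s)).le) (mem_univ s))
      (hp s).le
  have hc0 : 0 < c := pos_of_mul_pos_left (zero_lt_one.trans_le (hcp s₀)) (hp s₀).le
  set K := |v| + M + 1
  have hK0 : 0 < K := by positivity
  obtain ⟨N, hN⟩ := hv ((v - uVal g q) / (K * c)) (div_pos (by linarith) (by positivity))
  obtain ⟨n, hn⟩ : ∃ n, N < n := ⟨N + 1, N.lt_succ_self⟩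
  have hn0 : (0 : ℝ) < n := by exact_mod_cast N.zero_le.trans_lt hn
  set β : BehavStrategy A B SB B n := BehavStrategy.const _ y hy
  obtain ⟨α, hα⟩ := hN n hn β
  set P := playProb α β sA (TB s₀)
  have hP0 (a b) : 0 ≤ P a b := playProb_nonneg ..
  have hmean := sum_playProb_potential_le (fun a b => ∑ s, q s * g s a b) (fun z : ℝ => z)
    (uVal g q) α β sA (TB s₀) 0 fun i a b => by
      have hβi : β.prob i a b (TB s₀) = y := rfl
      rw [hβi, sum_mixed_const_add ⟨α.nonneg i a b sA, α.sum_one i a b sA⟩ hy]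
      refine add_le_add (le_refl _) ((sum_le_sum fun a' _ =>
        mul_le_mul_of_nonneg_left (hyu a') (α.nonneg ..)).trans_eq ?_)
      rw [← sum_mul, α.sum_one, one_mul]
  simp only [zero_add] at hmean
  have havg (s : S) (a : Fin n → A) (b : Fin n → B) : -M ≤ avgPay g s a b := by
    have : ∑ i : Fin n, -M ≤ ∑ i, g s (a i) (b i) :=
      sum_le_sum fun i _ => (abs_le.1 (hM s (a i) (b i))).1
    rw [avgPay, inv_mul_eq_div, le_div_iff₀ hn0]
    simpa [mul_comm] using this
  have hqavg (a : Fin n → A) (b : Fin n → B) :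
      ∑ i, ∑ s, q s * g s (a i) (b i) = n * ∑ s, q s * avgPay g s a b := by
    rw [sum_comm, mul_sum]
    refine sum_congr rfl fun s _ => ?_
    rw [avgPay, ← mul_sum]
    field_simp
  simp_rw [hqavg] at hmean
  have hmean' : ∑ a, ∑ b, P a b * ∑ s, q s * avgPay g s a b ≤ uVal g q := by
    refine le_of_mul_le_mul_left (le_trans (le_of_eq ?_) hmean) hn0
    simp_rw [mul_sum]
    exact sum_congr rfl fun _ _ => sum_congr rfl fun _ _ => sum_congr rfl fun _ _ => by ring
  have hone : ∑ a, ∑ b, P a b = 1 := sum_playProb α β sA (TB s₀)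
  have hfin : v - uVal g q ≤ K * c * probBelow g p TA TB α β v :=
    calc v - uVal g q ≤ v - ∑ a, ∑ b, P a b * ∑ s, q s * avgPay g s a b := by linarith
      _ = ∑ a, ∑ b, P a b * ∑ s, q s * (v - avgPay g s a b) := by
          simp_rw [mul_sub, sum_sub_distrib, ← sum_mul, hq.2, one_mul, mul_sub, sum_sub_distrib,
            ← sum_mul, hone, one_mul]
      _ ≤ ∑ a, ∑ b, ∑ s, q s * (K * Set.indicator
            {c : (Fin n → A) × (Fin n → B) | avgPay g s c.1 c.2 < v}
            (fun c => P c.1 c.2) (a, b)) := by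
          refine sum_le_sum fun a _ => sum_le_sum fun b _ => ?_
          rw [mul_sum]
          refine sum_le_sum fun s _ => ?_
          rw [mul_left_comm]
          refine mul_le_mul_of_nonneg_left ?_ (hq.1 s)
          by_cases h : avgPay g s a b < v
          · rw [Set.indicator_of_mem (by exact h), mul_comm]
            exact mul_le_mul_of_nonneg_right (by linarith [havg s a b, le_abs_self v]) (hP0 a b)
          · rw [Set.indicator_of_notMem (by exact h), mul_zero]
            exact mul_nonpos_of_nonneg_of_nonpos (hP0 a b) (by linarith)
      _ = ∑ s, q s * (K * ∑ a, ∑ b, Set.indicator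
            {c : (Fin n → A) × (Fin n → B) | avgPay g s c.1 c.2 < v}
            (fun c => P c.1 c.2) (a, b)) := by
          simp_rw [mul_sum]
          exact (sum_congr rfl fun _ _ => sum_comm).trans sum_comm
      _ ≤ _ := by
          rw [probBelow_eq, mul_sum]
          refine sum_le_sum fun s _ => ?_
          by_cases hs : q s = 0
          · rw [hs, zero_mul]
            exact mul_nonneg (by positivity) (mul_nonneg (hp s).le (sum_nonneg fun _ _ =>
              sum_nonneg fun _ _ => Set.indicator_nonneg (fun _ _ => playProb_nonneg ..) _))
          · rw [hsupp s hs]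
            have h1 : q s ≤ c * p s := (hq.2 ▸ single_le_sum (fun s _ => hq.1 s)
              (mem_univ s) : q s ≤ 1).trans (hcp s)
            refine (mul_le_mul_of_nonneg_right h1 (mul_nonneg hK0.le (sum_nonneg fun _ _ =>
              sum_nonneg fun _ _ => Set.indicator_nonneg (fun _ _ => hP0 ..) _))).trans_eq ?_
            rw [mul_mul_mul_comm, mul_comm c K]
            rfl
  rw [lt_div_iff₀ (by positivity)] at hα
  linarith

open scoped Classical in
/-- The positive parts of the coordinates of the accumulated shortfall `D` that are compatible with
Alice's side information `sA`. -/
noncomputable def shortfallWeight (TA : S → SA) (sA : SA) (D : S → ℝ) (s : S) : ℝ :=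
  if TA s = sA then max (D s) 0 else 0

omit [Fintype S] in
theorem shortfallWeight_nonneg (TA : S → SA) (sA : SA) (D : S → ℝ) (s : S) :
    0 ≤ shortfallWeight TA sA D s := by
  unfold shortfallWeight
  split_ifs <;> simp

omit [Fintype S] in
theorem shortfallWeight_add_sq_le (TA : S → SA) (sA : SA) (D d : S → ℝ) (s : S) :
    shortfallWeight TA sA (D + d) s ^ 2 ≤
      shortfallWeight TA sA D s ^ 2 + 2 * (shortfallWeight TA sA D s * d s) + d s ^ 2 := by
  unfold shortfallWeight
  split_ifs
  · simp only [Pi.add_apply]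
    rcases max_cases (D s + d s) 0 with h | h <;> rcases max_cases (D s) 0 with h' | h' <;>
      rw [h.1, h'.1] <;> nlinarith
  · nlinarith

/-- Blackwell's condition: if the value of every averaged game compatible with `sA` exceeds `w`,
then Alice has a mixed action that does not increase the weighted shortfall. -/
theorem exists_mixed_shortfall_le [Nonempty A] [Nonempty B] {g : S → A → B → ℝ} {TA : S → SA}
    {sA : SA} {w : ℝ}
    (hw : ∀ q ∈ stdSimplex ℝ S, (∀ s, q s ≠ 0 → TA s = sA) → w < uVal g q) (D : S → ℝ) :
    ∃ x ∈ stdSimplex ℝ A,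
      ∀ b, ∑ a, x a * ∑ s, shortfallWeight TA sA D s * (w - g s a b) ≤ 0 := by
  classical
  set c := shortfallWeight TA sA D with hc
  have hc0 : ∀ s, 0 ≤ c s := shortfallWeight_nonneg TA sA D
  rcases (sum_nonneg fun s (_ : s ∈ univ) => hc0 s).eq_or_lt with h | h
  · have hz (s) : c s = 0 := (sum_eq_zero_iff_of_nonneg fun s _ => hc0 s).1 h.symm s (mem_univ s)
    exact ⟨_, single_mem_stdSimplex ℝ (Classical.arbitrary A), fun b => by simp [hz]⟩
  · set q : S → ℝ := fun s => (∑ s, c s)⁻¹ * c s with hq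
    have hqc (s) : c s = (∑ s, c s) * q s := by simp only [hq]; field_simp
    have hqm : q ∈ stdSimplex ℝ S :=
      ⟨fun s => mul_nonneg (inv_pos.2 h).le (hc0 s), by rw [← mul_sum, inv_mul_cancel₀ h.ne']⟩
    have hlt := hw q hqm fun s hs => by
      by_contra hne
      exact hs (by simp [hq, hc, shortfallWeight, hne])
    have : Nonempty {x : A → ℝ // (∀ a, 0 ≤ x a) ∧ ∑ a, x a = 1} :=
      ⟨_, single_mem_stdSimplex ℝ (Classical.arbitrary A)⟩
    obtain ⟨⟨x, hx⟩, hxw⟩ := exists_lt_of_lt_ciSup hlt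
    refine ⟨x, hx, fun b => ?_⟩
    have hb : w ≤ ∑ s, ∑ a, q s * x a * g s a b :=
      hxw.le.trans (ciInf_le (Set.finite_range _).bddBelow b)
    have heq : ∑ a, x a * ∑ s, c s * (w - g s a b) =
        (∑ s, c s) * (w - ∑ s, ∑ a, q s * x a * g s a b) := by
      have hww : w = ∑ s, ∑ a, q s * x a * w := by
        simp_rw [← sum_mul, ← mul_sum, hx.2, mul_one, hqm.2, one_mul]
      conv_rhs => rw [hww]
      simp_rw [mul_sum, ← sum_sub_distrib, mul_sum]
      rw [sum_comm]
      exact sum_congr rfl fun s _ => sum_congr rfl fun a _ => by rw [hqc s]; ring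
    rw [heq]
    exact mul_nonpos_of_nonneg_of_nonpos h.le (by linarith)

/-- The strategy at each stage playing the mixed action attached by `x` to the side information and
to the accumulated sum of `d`. -/
def BehavStrategy.ofPartialSum {E : Type*} [AddCommMonoid E] (d : A → B → E) (n : ℕ)
    (x : SA → E → A → ℝ) (hx : ∀ si D, x si D ∈ stdSimplex ℝ A) : BehavStrategy A B SA A n where
  prob i ha hb si := x si (partialSum d i ha hb)
  nonneg _ _ _ _ := (hx _ _).1
  sum_one _ _ _ _ := (hx _ _).2
  causal i ha ha' hb hb' si hab hbb := by
    congr 1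
    refine sum_congr rfl fun j _ => ?_
    split_ifs with h
    · rw [hab j h, hbb j h]
    · rfl

/-- Blackwell's approachability argument: any value below all `u(q)` with `q` compatible with a
single side information of Alice is strongly guaranteed. -/
theorem stronglyGuarantees_of_lt [Nonempty A] [Nonempty B] {g : S → A → B → ℝ} {p : S → ℝ}
    (hp : ∀ s, 0 < p s) (hp1 : ∑ s, p s = 1) {TA : S → SA} {TB : S → SB} {v w : ℝ} (hvw : v < w)
    (hw : ∀ sA, ∀ q ∈ stdSimplex ℝ S, (∀ s, q s ≠ 0 → TA s = sA) → w < uVal g q) :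
    StronglyGuarantees g p TA TB v := by
  intro ε hε
  obtain ⟨M, hM0, hM⟩ := exists_payoff_bound g
  choose x hx hxw using fun sA => exists_mixed_shortfall_le (hw sA)
  set d : A → B → S → ℝ := fun a b s => w - g s a b with hd
  set C : ℝ := Fintype.card S * (|w| + M) ^ 2 with hC
  have hdC (a b) : ∑ s, d a b s ^ 2 ≤ C := by
    have : ∑ s, d a b s ^ 2 ≤ ∑ s : S, (|w| + M) ^ 2 := sum_le_sum fun s _ => by
      refine sq_le_sq.2 ((abs_sub w (g s a b)).trans ?_)
      exact (add_le_add_right (hM s a b) _).trans (le_abs_self _)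
    simpa [hC] using this
  obtain ⟨N, hN⟩ := exists_nat_gt (C / ((w - v) ^ 2 * ε))
  refine ⟨N, fun n hn => ⟨BehavStrategy.ofPartialSum d n x hx, fun β => ?_⟩⟩
  set α : BehavStrategy A B SA A n := BehavStrategy.ofPartialSum d n x hx
  have hn0 : (0 : ℝ) < n := by exact_mod_cast N.zero_le.trans_lt hn
  have hη : 0 < w - v := sub_pos.2 hvw
  have hstate (s : S) : n * (w - v) ^ 2 * ∑ a, ∑ b,
      Set.indicator {c : (Fin n → A) × (Fin n → B) | avgPay g s c.1 c.2 < v}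
        (fun c => playProb α β (TA s) (TB s) c.1 c.2) (a, b) ≤ C := by
    have hdrift := sum_playProb_potential_le d
      (fun D => ∑ s', shortfallWeight TA (TA s) D s' ^ 2) C α β (TA s) (TB s) 0 fun i a b => by
        rw [zero_add]
        set D := partialSum d i a b
        set c := shortfallWeight TA (TA s) D
        have hαi : α.prob i a b (TA s) = x (TA s) D := rfl
        have hβi : β.prob i a b (TB s) ∈ stdSimplex ℝ B := ⟨β.nonneg _ _ _ _, β.sum_one ..⟩
        rw [hαi]
        set y := β.prob i a b (TB s)
        calc _ ≤ ∑ a', ∑ b', x (TA s) D a' * y b' *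
              ((∑ s', c s' ^ 2 + C) + 2 * ∑ s', c s' * d a' b' s') := by
              refine sum_le_sum fun a' _ => sum_le_sum fun b' _ =>
                mul_le_mul_of_nonneg_left ?_ (mul_nonneg ((hx _ _).1 _) (hβi.1 _))
              have := sum_le_sum fun s' (_ : s' ∈ univ) =>
                shortfallWeight_add_sq_le TA (TA s) D (d a' b') s'
              rw [sum_add_distrib, sum_add_distrib, ← mul_sum] at this
              linarith [hdC a' b']
          _ = (∑ s', c s' ^ 2 + C) +
              2 * ∑ b', y b' * ∑ a', x (TA s) D a' * ∑ s', c s' * d a' b' s' := by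
              rw [sum_mixed_const_add (hx _ _) hβi]
              simp_rw [mul_sum]
              rw [sum_comm]
              congr 1
              exact sum_congr rfl fun _ _ => sum_congr rfl fun _ _ => sum_congr rfl fun _ _ => by
                ring
          _ ≤ _ := by
              have := sum_nonpos fun b' (_ : b' ∈ univ) =>
                mul_nonpos_of_nonneg_of_nonpos (hβi.1 b') (hxw (TA s) D b')
              linarith
    have hzero : ∑ s', shortfallWeight TA (TA s) 0 s' ^ 2 = 0 := by simp [shortfallWeight]
    rw [hzero, zero_add] at hdrift
    refine le_of_mul_le_mul_left (le_trans ?_ hdrift) hn0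
    simp_rw [mul_sum]
    refine sum_le_sum fun a _ => sum_le_sum fun b _ => ?_
    have hP0 := playProb_nonneg α β (TA s) (TB s) a b
    by_cases h : avgPay g s a b < v
    · rw [Set.indicator_of_mem (by exact h), ← mul_sum, zero_add]
      have hD : n * (w - v) ≤ (∑ i, d (a i) (b i)) s := by
        rw [avgPay, inv_mul_eq_div, div_lt_iff₀ hn0] at h
        simp only [hd, Finset.sum_apply, sum_sub_distrib, sum_const, card_univ, Fintype.card_fin,
          nsmul_eq_mul]
        linarith
      have hΦ : (n * (w - v)) ^ 2 ≤
          ∑ s', shortfallWeight TA (TA s) (∑ i, d (a i) (b i)) s' ^ 2 := by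
        refine le_trans ?_ (single_le_sum (fun s' _ => sq_nonneg _) (mem_univ s))
        refine pow_le_pow_left₀ (by positivity) ?_ 2
        rw [shortfallWeight, if_pos rfl]
        exact hD.trans (le_max_left _ _)
      calc _ = playProb α β (TA s) (TB s) a b * (n * (w - v)) ^ 2 := by ring
        _ ≤ _ := mul_le_mul_of_nonneg_left hΦ hP0
    · rw [Set.indicator_of_notMem (by exact h)]
      simp only [mul_zero]
      exact sum_nonneg fun _ _ => mul_nonneg hP0 (sq_nonneg _)
  have htotal : n * (w - v) ^ 2 * probBelow g p TA TB α β v ≤ C := by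
    rw [probBelow_eq, mul_sum]
    calc _ ≤ ∑ s, p s * C := sum_le_sum fun s _ => by
          rw [mul_left_comm]
          exact mul_le_mul_of_nonneg_left (hstate s) (hp s).le
      _ = C := by rw [← sum_mul, hp1, one_mul]
  have hCn : C < n * (w - v) ^ 2 * ε := by
    rw [mul_assoc, ← div_lt_iff₀ (by positivity)]
    exact hN.trans (by exact_mod_cast hn)
  exact lt_of_mul_lt_mul_left (htotal.trans_lt hCn) (by positivity)

theorem StronglyGuarantees.weaklyGuarantees {g : S → A → B → ℝ} {p : S → ℝ} {TA : S → SA}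
    {TB : S → SB} {v : ℝ} (h : StronglyGuarantees g p TA TB v) : WeaklyGuarantees g p TA TB v :=
  fun ε hε => (h ε hε).imp fun _ hN n hn β => (hN n hn).imp fun _ hα => hα β

theorem csSup_eq_of_Iio_subset_of_subset_Iic {s : Set ℝ} {L : ℝ} (h : Set.Iio L ⊆ s)
    (h' : s ⊆ Set.Iic L) : sSup s = L :=
  csSup_eq_of_forall_le_of_forall_lt_exists_gt (Set.nonempty_Iio.mono h) h' fun _ hw =>
    let ⟨z, hwz, hzL⟩ := exists_between hw
    ⟨z, h hzL, hwz⟩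

/-- The suprema of strongly and weakly guaranteeable values coincide and
equal `min_{s_A} inf { u(q) : support(q) ⊆ 𝒯_A⁻¹(s_A) }`. -/
theorem stmt0 {S SA SB A B : Type*} [Fintype S] [Fintype SA] [Fintype SB] [Fintype A] [Fintype B]
    [Nonempty S] [Nonempty SA] [Nonempty SB] [Nonempty A] [Nonempty B]
    (g : S → A → B → ℝ) (p : S → ℝ) (hp : ∀ s, 0 < p s) (hp1 : ∑ s, p s = 1)
    (TA : S → SA) (TB : S → SB) (hTA : Function.Surjective TA) :
    vsupS g p TA TB = vsupW g p TA TB ∧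
    vsupS g p TA TB =
      ⨅ sA : SA,
        ⨅ q : {q : S → ℝ // (∀ s, 0 ≤ q s) ∧ (∑ s, q s = 1) ∧ ∀ s, q s ≠ 0 → TA s = sA},
          uVal g q.1 := by
  obtain ⟨M, -, hM⟩ := exists_payoff_bound g
  set L := ⨅ sA : SA,
    ⨅ q : {q : S → ℝ // (∀ s, 0 ≤ q s) ∧ (∑ s, q s = 1) ∧ ∀ s, q s ≠ 0 → TA s = sA}, uVal g q.1
  have hle (sA : SA) (q : S → ℝ) (hq : q ∈ stdSimplex ℝ S) (hsupp : ∀ s, q s ≠ 0 → TA s = sA) :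
      L ≤ uVal g q := by
    refine (ciInf_le (Set.finite_range _).bddBelow sA).trans (ciInf_le (f := fun q : {q : S → ℝ //
      (∀ s, 0 ≤ q s) ∧ (∑ s, q s = 1) ∧ ∀ s, q s ≠ 0 → TA s = sA} => uVal g q.1) ⟨-M, ?_⟩
      ⟨q, hq.1, hq.2, hsupp⟩)
    rintro _ ⟨q, rfl⟩
    classical
    have hx := single_mem_stdSimplex ℝ (Classical.arbitrary A)
    exact (le_ciInf fun b => (abs_le.1 (abs_mixed_payoff_le hM ⟨q.2.1, q.2.2.1⟩ hx b)).1).trans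
      (iInf_le_uVal g ⟨q.2.1, q.2.2.1⟩ hx)
  have hstrong (v : ℝ) (hv : v < L) : StronglyGuarantees g p TA TB v := by
    obtain ⟨w, hvw, hwL⟩ := exists_between hv
    exact stronglyGuarantees_of_lt hp hp1 hvw fun sA q hq hsupp =>
      hwL.trans_le (hle sA q hq hsupp)
  have hweak (v : ℝ) (hv : WeaklyGuarantees g p TA TB v) : v ≤ L := by
    refine le_ciInf fun sA => ?_
    obtain ⟨s, hs⟩ := hTA sA
    classical
    have : Nonempty {q : S → ℝ //
        (∀ s, 0 ≤ q s) ∧ (∑ s, q s = 1) ∧ ∀ s, q s ≠ 0 → TA s = sA} :=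
      ⟨Pi.single s 1, (single_mem_stdSimplex ℝ s).1, (single_mem_stdSimplex ℝ s).2,
        fun t ht => by
          rcases eq_or_ne t s with rfl | hne
          · exact hs
          · exact absurd (Pi.single_eq_of_ne hne _) ht⟩
    exact le_ciInf fun q => le_uVal_of_weaklyGuarantees hp hv ⟨q.2.1, q.2.2.1⟩ q.2.2.2
  have hS : vsupS g p TA TB = L := csSup_eq_of_Iio_subset_of_subset_Iic hstrong
    fun v hv => hweak v (StronglyGuarantees.weaklyGuarantees hv)
  have hW : vsupW g p TA TB = L := csSup_eq_of_Iio_subset_of_subset_Iic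
    (fun v hv => (hstrong v hv).weaklyGuarantees) hweak
  exact ⟨hS.trans hW.symm, hS⟩
end

section
/- There exists a constant C > 0 such that for every probability distribution q on 𝒮 and every n ≥ 1, 0 ≤ (vex u)(q) − V_n(q) ≤ C / √n. In particular, V_n(q) converges to (vex u)(q) as n → ∞, uniformly in q. -/
open Finset

variable {S SA SB A B : Type*} [Fintype S] [Fintype A] [Fintype B]

/-! ### Causal kernels on finite sequences -/

/-- A stochastic process with values in a finite type `C`, of length `n`, given by its
conditional distributions. -/
structure CausalKernel (C : Type*) [Fintype C] (n : ℕ) where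
  prob : Fin n → (Fin n → C) → C → ℝ
  nonneg : ∀ i c x, 0 ≤ prob i c x
  sum_one : ∀ i c, ∑ x, prob i c x = 1
  causal : ∀ (i : Fin n) (c c' : Fin n → C), (∀ j : Fin n, (j : ℕ) < (i : ℕ) → c j = c' j) →
    prob i c = prob i c'

namespace CausalKernel

variable {C : Type*} [Fintype C] {n : ℕ} (k : CausalKernel C n)

/-- The expectation of a function of the whole sequence. -/
noncomputable def expect (F : (Fin n → C) → ℝ) : ℝ := ∑ c, (∏ i, k.prob i c (c i)) * F c

/-- The weight of a sequence drawn from the kernel before time `m` and uniformly afterwards. -/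
noncomputable def weight (m : ℕ) (c : Fin n → C) : ℝ :=
  ∏ j : Fin n, if (j : ℕ) < m then k.prob j c (c j) else (Fintype.card C : ℝ)⁻¹

theorem weight_nonneg (m : ℕ) (c : Fin n → C) : 0 ≤ k.weight m c :=
  Finset.prod_nonneg fun j _ => by
    split_ifs
    · exact k.nonneg _ _ _
    · positivity

theorem weight_length (c : Fin n → C) : k.weight n c = ∏ i, k.prob i c (c i) :=
  Finset.prod_congr rfl fun j _ => by simp

theorem sum_update_eq (i : Fin n) (F : (Fin n → C) → ℝ) :
    ∑ c, ∑ x, F (Function.update c i x) = Fintype.card C * ∑ c, F c := by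
  have hinv : Function.Involutive
      (fun p : (Fin n → C) × C => (Function.update p.1 i p.2, p.1 i)) := by
    rintro ⟨c, x⟩
    simp
  calc ∑ c, ∑ x, F (Function.update c i x)
      = ∑ p : (Fin n → C) × C, F (hinv.toPerm _ p).1 := by
        rw [Fintype.sum_prod_type]; rfl
    _ = ∑ p : (Fin n → C) × C, F p.1 := Equiv.sum_comp (hinv.toPerm _) fun p => F p.1
    _ = Fintype.card C * ∑ c, F c := by
        rw [Fintype.sum_prod_type, Finset.mul_sum]
        simp

theorem weight_succ_update [Nonempty C] (i : Fin n) (c : Fin n → C) (x : C) :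
    k.weight (i + 1) (Function.update c i x) = Fintype.card C * (k.weight i c * k.prob i c x) := by
  unfold weight
  rw [← Finset.mul_prod_erase _ _ (Finset.mem_univ i),
    ← Finset.mul_prod_erase _ _ (Finset.mem_univ i)]
  have h : ∏ j ∈ Finset.univ.erase i, (if (j : ℕ) < i + 1 then
        k.prob j (Function.update c i x) (Function.update c i x j) else (Fintype.card C : ℝ)⁻¹)
      = ∏ j ∈ Finset.univ.erase i, (if (j : ℕ) < i then k.prob j c (c j)
          else (Fintype.card C : ℝ)⁻¹) := by
    refine Finset.prod_congr rfl fun j hj => ?_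
    have hji : j ≠ i := Finset.ne_of_mem_erase hj
    have hji' : (j : ℕ) ≠ i := fun h => hji (Fin.ext h)
    by_cases hlt : (j : ℕ) < i
    · rw [if_pos (by omega), if_pos hlt, Function.update_of_ne hji]
      rw [k.causal j _ c fun l hl => Function.update_of_ne (by rintro rfl; omega) _ _]
    · rw [if_neg (by omega), if_neg hlt]
  have hi : k.prob i (Function.update c i x) = k.prob i c :=
    k.causal i _ _ fun l hl => Function.update_of_ne (by rintro rfl; omega) _ _
  have hC : (Fintype.card C : ℝ) ≠ 0 := by exact_mod_cast Fintype.card_ne_zero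
  rw [h, hi]
  simp
  field_simp

theorem sum_weight_succ [Nonempty C] (i : Fin n) (F : (Fin n → C) → ℝ) :
    ∑ c, k.weight (i + 1) c * F c =
      ∑ c, k.weight i c * ∑ x, k.prob i c x * F (Function.update c i x) := by
  have hC : (Fintype.card C : ℝ) ≠ 0 := by exact_mod_cast Fintype.card_ne_zero
  have h := sum_update_eq i fun c => k.weight (i + 1) c * F c
  refine mul_left_cancel₀ hC ?_
  rw [← h, Finset.mul_sum]
  refine Finset.sum_congr rfl fun c _ => ?_
  rw [Finset.mul_sum, Finset.mul_sum]
  refine Finset.sum_congr rfl fun x _ => ?_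
  rw [weight_succ_update]
  ring

theorem sum_weight [Nonempty C] {m : ℕ} (hm : m ≤ n) : ∑ c, k.weight m c = 1 := by
  induction m with
  | zero =>
    have hC : (Fintype.card C : ℝ) ≠ 0 := by exact_mod_cast Fintype.card_ne_zero
    simp [weight, hC]
  | succ m ih =>
    have h := k.sum_weight_succ ⟨m, hm⟩ fun _ => 1
    simp only [mul_one, k.sum_one] at h
    rw [h, ih (by omega)]

/-- A potential that starts at `0` and has conditional drift at most `K` at every stage has
expectation at most `n * K` at the end. -/
theorem expect_le_of_drift [Nonempty C] (Φ : ℕ → (Fin n → C) → ℝ) (K : ℝ)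
    (h0 : ∀ c, Φ 0 c = 0)
    (hstep : ∀ (i : Fin n) c, ∑ x, k.prob i c x * Φ (i + 1) (Function.update c i x) ≤ Φ i c + K) :
    k.expect (Φ n) ≤ n * K := by
  have key : ∀ m ≤ n, ∑ c, k.weight m c * Φ m c ≤ m * K := by
    intro m
    induction m with
    | zero => simp [h0]
    | succ m ih =>
      intro hm
      calc ∑ c, k.weight (m + 1) c * Φ (m + 1) c
          = ∑ c, k.weight m c *
              ∑ x, k.prob ⟨m, hm⟩ c x * Φ (m + 1) (Function.update c ⟨m, hm⟩ x) :=
            k.sum_weight_succ ⟨m, hm⟩ (Φ (m + 1))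
        _ ≤ ∑ c, k.weight m c * (Φ m c + K) := Finset.sum_le_sum fun c _ =>
            mul_le_mul_of_nonneg_left (hstep ⟨m, hm⟩ c) (k.weight_nonneg _ _)
        _ = ∑ c, k.weight m c * Φ m c + K := by
            simp only [mul_add, Finset.sum_add_distrib]
            rw [← Finset.sum_mul, k.sum_weight (by omega), one_mul]
        _ ≤ ((m + 1 : ℕ) : ℝ) * K := by
            have := ih (by omega)
            push_cast
            linarith
  have := key n le_rfl
  simpa only [expect, weight_length] using this

theorem expect_const [Nonempty C] (r : ℝ) : k.expect (fun _ => r) = r := by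
  have := k.sum_weight le_rfl
  simp only [weight_length] at this
  rw [expect, ← Finset.sum_mul, this, one_mul]

theorem expect_mono {F G : (Fin n → C) → ℝ} (h : ∀ c, F c ≤ G c) : k.expect F ≤ k.expect G :=
  Finset.sum_le_sum fun c _ => mul_le_mul_of_nonneg_left (h c)
    (Finset.prod_nonneg fun _ _ => k.nonneg _ _ _)

theorem expect_add (F G : (Fin n → C) → ℝ) :
    k.expect (fun c => F c + G c) = k.expect F + k.expect G := by
  simp only [expect, mul_add, Finset.sum_add_distrib]

theorem expect_const_mul (r : ℝ) (F : (Fin n → C) → ℝ) :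
    k.expect (fun c => r * F c) = r * k.expect F := by
  simp only [expect, Finset.mul_sum]
  exact Finset.sum_congr rfl fun c _ => by ring

theorem expect_sum {ι : Type*} (t : Finset ι) (F : ι → (Fin n → C) → ℝ) :
    k.expect (fun c => ∑ i ∈ t, F i c) = ∑ i ∈ t, k.expect (F i) := by
  simp only [expect, Finset.mul_sum]
  exact Finset.sum_comm

end CausalKernel

/-! ### The law of the play -/

/-- The process of joint actions induced by two behavioral strategies, given the side
information of each player. -/
noncomputable def playKernel {n : ℕ} (α : BehavStrategy A B SA A n) (β : BehavStrategy A B SB B n)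
    (sa : SA) (sb : SB) : CausalKernel (A × B) n where
  prob i c x := α.prob i (fun j => (c j).1) (fun j => (c j).2) sa x.1 *
    β.prob i (fun j => (c j).1) (fun j => (c j).2) sb x.2
  nonneg i c x := mul_nonneg (α.nonneg _ _ _ _ _) (β.nonneg _ _ _ _ _)
  sum_one i c := by
    rw [Fintype.sum_prod_type]
    simp only [← Finset.mul_sum, β.sum_one, mul_one, α.sum_one]
  causal i c c' h := by
    rw [α.causal i _ (fun j => (c' j).1) _ (fun j => (c' j).2) sa (fun j hj => by rw [h j hj])
      (fun j hj => by rw [h j hj]),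
      β.causal i _ (fun j => (c' j).1) _ (fun j => (c' j).2) sb (fun j hj => by rw [h j hj])
      (fun j hj => by rw [h j hj])]

/-- Alice's expected average payoff in state `s`, against a state-dependent strategy. -/
noncomputable def statePay (g : S → A → B → ℝ) {n : ℕ} (α : BehavStrategy A B Unit A n)
    (β : BehavStrategy A B S B n) (s : S) : ℝ :=
  (playKernel α β () s).expect fun c => avgPay g s (fun j => (c j).1) (fun j => (c j).2)

theorem expPay_eq_sum_statePay (g : S → A → B → ℝ) (q : S → ℝ) {n : ℕ}
    (α : BehavStrategy A B Unit A n) (β : BehavStrategy A B S B n) :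
    expPay g q (fun _ => ()) (id : S → S) α β = ∑ s, q s * statePay g α β s := by
  refine Finset.sum_congr rfl fun s _ => ?_
  rw [statePay, CausalKernel.expect, Finset.mul_sum,
    ← (Equiv.arrowProdEquivProdArrow (Fin n) (fun _ => A) (fun _ => B)).symm.sum_comp,
    Fintype.sum_prod_type]
  refine Finset.sum_congr rfl fun a _ => Finset.sum_congr rfl fun b _ => ?_
  simp only [inducedP, playKernel, Equiv.arrowProdEquivProdArrow, id, Equiv.coe_fn_symm_mk]
  ring

theorem abs_avgPay_le {S A B : Type*} {g : S → A → B → ℝ} {M : ℝ}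
    (hM : ∀ s a b, |g s a b| ≤ M) {n : ℕ} (hn : 1 ≤ n) (s : S) (a : Fin n → A) (b : Fin n → B) :
    |avgPay g s a b| ≤ M := by
  have hn' : (0 : ℝ) < n := by exact_mod_cast hn
  rw [avgPay, abs_mul, abs_of_pos (inv_pos.2 hn'), inv_mul_le_iff₀ hn']
  calc |∑ i, g s (a i) (b i)| ≤ ∑ i, |g s (a i) (b i)| := Finset.abs_sum_le_sum_abs _ _
    _ ≤ ∑ _i : Fin n, M := Finset.sum_le_sum fun i _ => hM _ _ _
    _ = n * M := by simp

theorem abs_statePay_le {S A B : Type*} [Fintype A] [Fintype B] [Nonempty A] [Nonempty B]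
    {g : S → A → B → ℝ} {M : ℝ}
    (hM : ∀ s a b, |g s a b| ≤ M) {n : ℕ} (hn : 1 ≤ n)
    (α : BehavStrategy A B Unit A n) (β : BehavStrategy A B S B n) (s : S) :
    |statePay g α β s| ≤ M := by
  rw [abs_le]
  constructor
  · rw [← (playKernel α β () s).expect_const (-M)]
    exact CausalKernel.expect_mono _ fun c => (abs_le.1 (abs_avgPay_le hM hn _ _ _)).1
  · rw [← (playKernel α β () s).expect_const M]
    exact CausalKernel.expect_mono _ fun c => (abs_le.1 (abs_avgPay_le hM hn _ _ _)).2

theorem abs_expPay_le [Nonempty A] [Nonempty B] {g : S → A → B → ℝ} {M : ℝ}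
    (hM : ∀ s a b, |g s a b| ≤ M) {q : S → ℝ} (hq : q ∈ stdSimplex ℝ S) {n : ℕ} (hn : 1 ≤ n)
    (α : BehavStrategy A B Unit A n) (β : BehavStrategy A B S B n) :
    |expPay g q (fun _ => ()) (id : S → S) α β| ≤ M := by
  rw [expPay_eq_sum_statePay]
  calc |∑ s, q s * statePay g α β s| ≤ ∑ s, |q s * statePay g α β s| :=
        Finset.abs_sum_le_sum_abs _ _
    _ ≤ ∑ s, q s * M := Finset.sum_le_sum fun s _ => by
        rw [abs_mul, abs_of_nonneg (hq.1 s)]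
        exact mul_le_mul_of_nonneg_left (abs_statePay_le hM hn α β s) (hq.1 s)
    _ = M := by rw [← Finset.sum_mul, hq.2, one_mul]

instance BehavStrategy.instNonempty {SI Act : Type*} [Fintype Act] [Nonempty Act] {n : ℕ} :
    Nonempty (BehavStrategy A B SI Act n) :=
  ⟨{ prob := fun _ _ _ _ _ => (Fintype.card Act : ℝ)⁻¹
     nonneg := fun _ _ _ _ _ => by positivity
     sum_one := fun _ _ _ _ => by
      have : (Fintype.card Act : ℝ) ≠ 0 := by exact_mod_cast Fintype.card_ne_zero
      simp [this]
     causal := fun _ _ _ _ _ _ _ _ => rfl }⟩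

theorem bddBelow_expPay [Nonempty A] [Nonempty B] {g : S → A → B → ℝ} {M : ℝ}
    (hM : ∀ s a b, |g s a b| ≤ M) {q : S → ℝ} (hq : q ∈ stdSimplex ℝ S) {n : ℕ} (hn : 1 ≤ n)
    (α : BehavStrategy A B Unit A n) :
    BddBelow (Set.range fun β : BehavStrategy A B S B n =>
      expPay g q (fun _ => ()) (id : S → S) α β) :=
  ⟨-M, by rintro _ ⟨β, rfl⟩; exact (abs_le.1 (abs_expPay_le hM hq hn α β)).1⟩

theorem bddAbove_iInf_expPay [Nonempty A] [Nonempty B] {g : S → A → B → ℝ} {M : ℝ}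
    (hM : ∀ s a b, |g s a b| ≤ M) {q : S → ℝ} (hq : q ∈ stdSimplex ℝ S) {n : ℕ} (hn : 1 ≤ n) :
    BddAbove (Set.range fun α : BehavStrategy A B Unit A n => ⨅ β : BehavStrategy A B S B n,
      expPay g q (fun _ => ()) (id : S → S) α β) :=
  ⟨M, by
    rintro _ ⟨α, rfl⟩
    exact (ciInf_le (bddBelow_expPay hM hq hn α) (Classical.arbitrary _)).trans
      (abs_le.1 (abs_expPay_le hM hq hn α _)).2⟩

/-! ### The value of the repeated game is convex in the prior -/

/-- Bob's strategy that plays, in each state, the better of two given strategies. -/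
theorem exists_statePay_le_min {S A B : Type*} [Fintype A] [Fintype B] (g : S → A → B → ℝ)
    {n : ℕ} (α : BehavStrategy A B Unit A n) (β₁ β₂ : BehavStrategy A B S B n) :
    ∃ β : BehavStrategy A B S B n, ∀ s, statePay g α β s ≤ statePay g α β₁ s ∧
      statePay g α β s ≤ statePay g α β₂ s := by
  classical
  let sel : S → BehavStrategy A B S B n := fun s =>
    if statePay g α β₁ s ≤ statePay g α β₂ s then β₁ else β₂
  let β : BehavStrategy A B S B n :=
    { prob := fun i a b s => (sel s).prob i a b s
      nonneg := fun i a b s => (sel s).nonneg i a b s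
      sum_one := fun i a b s => (sel s).sum_one i a b s
      causal := fun i a a' b b' s => (sel s).causal i a a' b b' s }
  have hβ : ∀ s, statePay g α β s = statePay g α (sel s) s := fun s => rfl
  refine ⟨β, fun s => ?_⟩
  rw [hβ]
  by_cases h : statePay g α β₁ s ≤ statePay g α β₂ s
  · simp [sel, h]
  · simp only [sel, h, if_false]
    exact ⟨(not_le.1 h).le, le_rfl⟩

theorem convexOn_Vn [Nonempty A] [Nonempty B] (g : S → A → B → ℝ) {M : ℝ}
    (hM : ∀ s a b, |g s a b| ≤ M) {n : ℕ} (hn : 1 ≤ n) :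
    ConvexOn ℝ (stdSimplex ℝ S) fun q => Vn g q n := by
  refine ⟨convex_stdSimplex ℝ S, fun p hp q hq r t hr ht hrt => ?_⟩
  refine ciSup_le fun α => ?_
  have hpq := convex_stdSimplex ℝ S hp hq hr ht hrt
  calc (⨅ β : BehavStrategy A B S B n, expPay g (r • p + t • q) (fun _ => ()) (id : S → S) α β)
      ≤ r * (⨅ β : BehavStrategy A B S B n, expPay g p (fun _ => ()) (id : S → S) α β) +
        t * (⨅ β : BehavStrategy A B S B n, expPay g q (fun _ => ()) (id : S → S) α β) := by
        rw [Real.mul_iInf_of_nonneg hr, Real.mul_iInf_of_nonneg ht]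
        refine le_ciInf_add_ciInf fun β₁ β₂ => ?_
        obtain ⟨β, hβ⟩ := exists_statePay_le_min g α β₁ β₂
        refine (ciInf_le (bddBelow_expPay hM hpq hn α) β).trans ?_
        simp only [expPay_eq_sum_statePay, Finset.mul_sum, ← Finset.sum_add_distrib]
        refine Finset.sum_le_sum fun s _ => ?_
        have h1 := mul_le_mul_of_nonneg_left (hβ s).1 (mul_nonneg hr (hp.1 s))
        have h2 := mul_le_mul_of_nonneg_left (hβ s).2 (mul_nonneg ht (hq.1 s))
        simp only [Pi.add_apply, Pi.smul_apply, smul_eq_mul]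
        linarith
    _ ≤ r • Vn g p n + t • Vn g q n :=
        add_le_add
          (mul_le_mul_of_nonneg_left (le_ciSup (bddAbove_iInf_expPay hM hp hn) α) hr)
          (mul_le_mul_of_nonneg_left (le_ciSup (bddAbove_iInf_expPay hM hq hn) α) ht)

/-! ### The one-stage game -/

/-- Payoff of the averaged game when Alice plays the mixed action `x` and Bob plays `b`. -/
noncomputable def mixedPay (g : S → A → B → ℝ) (q : S → ℝ) (x : A → ℝ) (b : B) : ℝ :=
  ∑ s : S, ∑ a : A, q s * x a * g s a b


theorem mixedPay_sub {S A B : Type*} [Fintype S] [Fintype A] (g : S → A → B → ℝ) (p q : S → ℝ)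
    (x : A → ℝ) (b : B) :
    mixedPay g (p - q) x b = mixedPay g p x b - mixedPay g q x b := by
  simp only [mixedPay, Pi.sub_apply, sub_mul, Finset.sum_sub_distrib]

theorem abs_mixedPay_le {S A B : Type*} [Fintype S] [Fintype A] {g : S → A → B → ℝ} {M : ℝ}
    (hM : ∀ s a b, |g s a b| ≤ M) (q : S → ℝ) {x : A → ℝ} (hx : (∀ a, 0 ≤ x a) ∧ ∑ a, x a = 1)
    (b : B) :
    |mixedPay g q x b| ≤ M * ∑ s, |q s| := by
  calc |mixedPay g q x b| ≤ ∑ s : S, ∑ a : A, |q s * x a * g s a b| :=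
        (Finset.abs_sum_le_sum_abs _ _).trans
          (Finset.sum_le_sum fun s _ => Finset.abs_sum_le_sum_abs _ _)
    _ ≤ ∑ s : S, ∑ a : A, |q s| * x a * M := by
        refine Finset.sum_le_sum fun s _ => Finset.sum_le_sum fun a _ => ?_
        rw [abs_mul, abs_mul, abs_of_nonneg (hx.1 a)]
        exact mul_le_mul_of_nonneg_left (hM s a b) (mul_nonneg (abs_nonneg _) (hx.1 a))
    _ = M * ∑ s, |q s| := by
        simp only [← Finset.sum_mul, ← Finset.mul_sum, hx.2, mul_one]
        ring

theorem bddAbove_iInf_mixedPay [Nonempty B] {g : S → A → B → ℝ} {M : ℝ}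
    (hM : ∀ s a b, |g s a b| ≤ M) (q : S → ℝ) :
    BddAbove (Set.range fun x : {x : A → ℝ // (∀ a, 0 ≤ x a) ∧ ∑ a, x a = 1} =>
      ⨅ b : B, mixedPay g q x.1 b) :=
  ⟨M * ∑ s, |q s|, by
    rintro _ ⟨x, rfl⟩
    exact (ciInf_le (Set.finite_range _).bddBelow (Classical.arbitrary B)).trans
      (abs_le.1 (abs_mixedPay_le hM q x.2 _)).2⟩

theorem iInf_mixedPay_le_uVal [Nonempty B] {g : S → A → B → ℝ} {M : ℝ}
    (hM : ∀ s a b, |g s a b| ≤ M) (q : S → ℝ) {x : A → ℝ}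
    (hx : (∀ a, 0 ≤ x a) ∧ ∑ a, x a = 1) : ⨅ b : B, mixedPay g q x b ≤ uVal g q :=
  le_ciSup (bddAbove_iInf_mixedPay hM q) ⟨x, hx⟩

theorem nonempty_mixed [Nonempty A] :
    Nonempty {x : A → ℝ // (∀ a, 0 ≤ x a) ∧ ∑ a, x a = 1} :=
  ⟨⟨fun _ => (Fintype.card A : ℝ)⁻¹, fun _ => by positivity, by simp⟩⟩

theorem uVal_le_add [Nonempty A] [Nonempty B] {g : S → A → B → ℝ} {M : ℝ}
    (hM : ∀ s a b, |g s a b| ≤ M) (p q : S → ℝ) :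
    uVal g p ≤ uVal g q + M * ∑ s, |p s - q s| := by
  have := nonempty_mixed (A := A)
  refine ciSup_le fun x => ?_
  refine le_trans ?_ (add_le_add_left (iInf_mixedPay_le_uVal hM q x.2) _)
  rw [← sub_le_iff_le_add]
  refine le_ciInf fun b => ?_
  have h1 : (⨅ b : B, mixedPay g p x.1 b) ≤ mixedPay g p x.1 b :=
    ciInf_le (Set.finite_range _).bddBelow b
  have h2 := (abs_le.1 (abs_mixedPay_le hM (p - q) x.2 b)).2
  rw [mixedPay_sub] at h2
  simp only [Pi.sub_apply] at h2
  change (⨅ b : B, mixedPay g p x.1 b) - _ ≤ _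
  linarith

theorem continuous_uVal [Nonempty A] [Nonempty B] (g : S → A → B → ℝ) {M : ℝ}
    (hM : ∀ s a b, |g s a b| ≤ M) : Continuous (uVal g) := by
  refine continuous_iff_continuousAt.2 fun q => ?_
  have hlim : Filter.Tendsto (fun p : S → ℝ => M * ∑ s, |p s - q s|) (nhds q) (nhds 0) := by
    have : Continuous fun p : S → ℝ => M * ∑ s, |p s - q s| := by fun_prop
    simpa using this.tendsto q
  refine tendsto_iff_dist_tendsto_zero.2 (squeeze_zero (fun _ => dist_nonneg) (fun p => ?_) hlim)
  have h1 := uVal_le_add hM p q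
  have h2 := uVal_le_add hM q p
  simp only [abs_sub_comm (q _)] at h2
  rw [Real.dist_eq, abs_le]
  constructor <;> linarith

theorem uVal_le [Nonempty A] [Nonempty B] {g : S → A → B → ℝ} {M : ℝ}
    (hM : ∀ s a b, |g s a b| ≤ M) {q : S → ℝ} (hq : q ∈ stdSimplex ℝ S) : uVal g q ≤ M := by
  have := nonempty_mixed (A := A)
  refine ciSup_le fun x =>
    (ciInf_le (Set.finite_range _).bddBelow (Classical.arbitrary B)).trans ?_
  have h := (abs_le.1 (abs_mixedPay_le hM q x.2 (Classical.arbitrary B))).2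
  simp only [abs_of_nonneg (hq.1 _), hq.2, mul_one] at h
  exact h

/-! ### Bob guarantees `u` without using his information -/

theorem sum_play_update {C : Type*} {n : ℕ} (r : C → ℝ) (i : Fin n) (c : Fin n → C) (x : C) :
    ∑ j ∈ Finset.univ.filter (fun j : Fin n => (j : ℕ) < i + 1), r (Function.update c i x j) =
      ∑ j ∈ Finset.univ.filter (fun j : Fin n => (j : ℕ) < i), r (c j) + r x := by
  have hset : (Finset.univ.filter fun j : Fin n => (j : ℕ) < i + 1) =
      insert i (Finset.univ.filter fun j : Fin n => (j : ℕ) < i) := by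
    ext j
    simp only [Finset.mem_filter, Finset.mem_univ, true_and, Finset.mem_insert, Fin.ext_iff]
    omega
  rw [hset, Finset.sum_insert (by simp), Function.update_self, add_comm]
  congr 1
  refine Finset.sum_congr rfl fun j hj => ?_
  rw [Function.update_of_ne]
  rintro rfl
  simp at hj

theorem Vn_le_uVal [Nonempty A] [Nonempty B] {g : S → A → B → ℝ} {M : ℝ}
    (hM : ∀ s a b, |g s a b| ≤ M) {q : S → ℝ} (hq : q ∈ stdSimplex ℝ S) {n : ℕ} (hn : 1 ≤ n) :
    Vn g q n ≤ uVal g q := by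
  classical
  refine ciSup_le fun α => ?_
  choose best hbest using fun x : A → ℝ => 
    exists_eq_ciInf_of_finite (f := fun b => mixedPay g q x b)
  let β : BehavStrategy A B S B n :=
    { prob := fun i a b _ y => if y = best (α.prob i a b ()) then 1 else 0
      nonneg := fun i a b _ y => by split_ifs <;> norm_num
      sum_one := fun i a b _ => by simp
      causal := fun i a a' b b' s ha hb => by rw [α.causal i a a' b b' () ha hb] }
  refine (ciInf_le (bddBelow_expPay hM hq hn α) β).trans ?_
  have hn' : (0 : ℝ) < n := by exact_mod_cast hn
  obtain ⟨s₀⟩ : Nonempty S := by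
    by_contra h
    rw [not_nonempty_iff] at h
    simpa using hq.2
  let r : A × B → ℝ := fun x => ∑ s, q s * g s x.1 x.2
  have hker : ∀ s, playKernel α β () s = playKernel α β () s₀ := fun s => rfl
  have hpay : expPay g q (fun _ => ()) (id : S → S) α β =
      (n : ℝ)⁻¹ * (playKernel α β () s₀).expect
        fun c => ∑ j ∈ Finset.univ.filter (fun j : Fin n => (j : ℕ) < n), r (c j) := by
    rw [expPay_eq_sum_statePay, ← CausalKernel.expect_const_mul]
    simp only [statePay, hker, ← CausalKernel.expect_const_mul, ← CausalKernel.expect_sum]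
    congr 1
    funext c
    simp only [avgPay, r, Fin.is_lt, Finset.filter_true, Finset.mul_sum]
    rw [Finset.sum_comm]
    refine Finset.sum_congr rfl fun s _ => Finset.sum_congr rfl fun j _ => ?_
    ring
  rw [hpay, inv_mul_le_iff₀ hn']
  refine (playKernel α β () s₀).expect_le_of_drift
    (fun m c => ∑ j ∈ Finset.univ.filter (fun j : Fin n => (j : ℕ) < m), r (c j))
    _ (by simp) fun i c => ?_
  simp only [sum_play_update, mul_add, Finset.sum_add_distrib]
  rw [← Finset.sum_mul, CausalKernel.sum_one, one_mul]
  refine add_le_add_right ?_ _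
  set x := α.prob i (fun j => (c j).1) (fun j => (c j).2) () with hx
  calc ∑ y, (playKernel α β () s₀).prob i c y * r y = mixedPay g q x (best x) := by
        simp only [Fintype.sum_prod_type, playKernel, β, r, mixedPay, ← hx]
        simp only [mul_ite, ite_mul, mul_one, mul_zero, zero_mul, Finset.sum_ite_eq',
          Finset.mem_univ, if_true]
        simp only [Finset.mul_sum]
        rw [Finset.sum_comm]
        refine Finset.sum_congr rfl fun s _ => Finset.sum_congr rfl fun a _ => ?_
        ring
    _ = ⨅ b, mixedPay g q x b := hbest x
    _ ≤ uVal g q := iInf_mixedPay_le_uVal hM q ⟨α.nonneg _ _ _ _, α.sum_one _ _ _ _⟩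

/-! ### Alice approaches an orthant -/

theorem sq_max_add_le (v d : ℝ) :
    max (v + d) 0 ^ 2 ≤ max v 0 ^ 2 + 2 * (max v 0 * d) + d ^ 2 := by
  rcases le_total v 0 with hv | hv
  · rw [max_eq_right hv]
    rcases le_total (v + d) 0 with h | h
    · rw [max_eq_right h]; nlinarith [sq_nonneg d]
    · rw [max_eq_left h]; nlinarith
  · rw [max_eq_left hv]
    rcases le_total (v + d) 0 with h | h
    · rw [max_eq_right h]; nlinarith [sq_nonneg (v + d)]
    · rw [max_eq_left h]; nlinarith

/-- Blackwell approachability of the orthant `{v | ∀ s, y s ≤ v s}` in vector payoffs, with rate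
`1 / √n`, under Blackwell's condition. -/
theorem exists_strategy_le_statePay [Nonempty A] [Nonempty B] {g : S → A → B → ℝ} {M : ℝ}
    (hMpos : 0 < M) (hM : ∀ s a b, |g s a b| ≤ M) {y : S → ℝ} (hy : ∀ s, |y s| ≤ M)
    (hblack : ∀ v : S → ℝ, ∃ x : A → ℝ, (∀ a, 0 ≤ x a) ∧ ∑ a, x a = 1 ∧
      ∀ b, ∑ s, ∑ a, max (v s) 0 * x a * (y s - g s a b) ≤ 0)
    {n : ℕ} (hn : 1 ≤ n) :
    ∃ α : BehavStrategy A B Unit A n, ∀ (β : BehavStrategy A B S B n) (s : S),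
      y s - Real.sqrt (Fintype.card S * (4 * M ^ 2)) / Real.sqrt n ≤ statePay g α β s := by
  choose x hx0 hx1 hx using hblack
  let d : S → A × B → ℝ := fun s c => y s - g s c.1 c.2
  let R : ℕ → (Fin n → A × B) → S → ℝ := fun m c s =>
    ∑ j ∈ Finset.univ.filter (fun j : Fin n => (j : ℕ) < m), d s (c j)
  let α : BehavStrategy A B Unit A n :=
    { prob := fun i a b _ => x (R i fun j => (a j, b j))
      nonneg := fun i a b _ => hx0 _
      sum_one := fun i a b _ => hx1 _
      causal := fun i a a' b b' _ ha hb => by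
        congr 1
        funext s
        refine Finset.sum_congr rfl fun j hj => ?_
        have hj' := (Finset.mem_filter.1 hj).2
        change d s (a j, b j) = d s (a' j, b' j)
        rw [ha j hj', hb j hj'] }
  refine ⟨α, fun β s₀ => ?_⟩
  set k := playKernel α β () s₀ with hk
  set K : ℝ := Fintype.card S * (4 * M ^ 2) with hK
  have hcard : (0 : ℝ) < Fintype.card S := by
    have : Nonempty S := ⟨s₀⟩
    exact_mod_cast Fintype.card_pos
  have hKpos : 0 < K := by positivity
  have hn' : (0 : ℝ) < n := by exact_mod_cast hn
  have hd : ∀ s c, d s c ^ 2 ≤ 4 * M ^ 2 := fun s c => by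
    have h1 := abs_le.1 (hy s)
    have h2 := abs_le.1 (hM s c.1 c.2)
    have : |d s c| ≤ 2 * M := abs_le.2 ⟨by simp only [d]; linarith, by simp only [d]; linarith⟩
    calc d s c ^ 2 = |d s c| ^ 2 := (sq_abs _).symm
      _ ≤ (2 * M) ^ 2 := by gcongr
      _ = 4 * M ^ 2 := by ring
  have hΦ : k.expect (fun c => ∑ s, max (R n c s) 0 ^ 2) ≤ n * K := by
    refine k.expect_le_of_drift (fun m c => ∑ s, max (R m c s) 0 ^ 2) K (by simp [R])
      fun i c => ?_
    have hR : ∀ z s, R (i + 1) (Function.update c i z) s = R i c s + d s z := fun z s =>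
      sum_play_update (d s) i c z
    have hcross : ∑ z, k.prob i c z * ∑ s, max (R i c s) 0 * d s z ≤ 0 := by
      have hprob : ∀ z, k.prob i c z = x (R i c) z.1 *
          β.prob i (fun j => (c j).1) (fun j => (c j).2) s₀ z.2 := fun z => rfl
      simp only [hprob]
      rw [Fintype.sum_prod_type, Finset.sum_comm]
      refine Finset.sum_nonpos fun b _ => ?_
      have := mul_nonpos_of_nonneg_of_nonpos
        (β.nonneg i (fun j => (c j).1) (fun j => (c j).2) s₀ b) (hx (R i c) b)
      refine le_of_eq_of_le ?_ this
      rw [Finset.sum_comm]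
      simp only [Finset.mul_sum, d]
      refine Finset.sum_congr rfl fun a _ => Finset.sum_congr rfl fun s _ => ?_
      ring
    calc ∑ z, k.prob i c z * ∑ s, max (R (i + 1) (Function.update c i z) s) 0 ^ 2
        ≤ ∑ z, k.prob i c z *
            (∑ s, max (R i c s) 0 ^ 2 + 2 * ∑ s, max (R i c s) 0 * d s z + K) := by
          refine Finset.sum_le_sum fun z _ => mul_le_mul_of_nonneg_left ?_ (k.nonneg _ _ _)
          have hKs : K = ∑ _s : S, 4 * M ^ 2 := by simp [hK]
          rw [hKs, Finset.mul_sum, ← Finset.sum_add_distrib, ← Finset.sum_add_distrib]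
          refine Finset.sum_le_sum fun s _ => ?_
          rw [hR]
          linarith [sq_max_add_le (R i c s) (d s z), hd s z]
      _ = ∑ s, max (R i c s) 0 ^ 2 +
            2 * (∑ z, k.prob i c z * ∑ s, max (R i c s) 0 * d s z) + K := by
          simp only [mul_add, Finset.sum_add_distrib, ← Finset.sum_mul, k.sum_one, one_mul]
          rw [Finset.mul_sum]
          congr 2
          exact Finset.sum_congr rfl fun z _ => by ring
      _ ≤ ∑ s, max (R i c s) 0 ^ 2 + K := by linarith
  have hsqrt : 0 < Real.sqrt (n * K) := Real.sqrt_pos.2 (by positivity)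
  set t := Real.sqrt (n * K) with ht
  have htt : t * t = n * K := Real.mul_self_sqrt (by positivity)
  have hpoint : ∀ c : Fin n → A × B, R n c s₀ ≤
      (2 * t)⁻¹ * ∑ s, max (R n c s) 0 ^ 2 + t / 2 := fun c => by
    have h1 : max (R n c s₀) 0 ^ 2 ≤ ∑ s, max (R n c s) 0 ^ 2 :=
      Finset.single_le_sum (f := fun s => max (R n c s) 0 ^ 2) (fun s _ => sq_nonneg _)
        (Finset.mem_univ s₀)
    have h2 : max (R n c s₀) 0 ≤ (2 * t)⁻¹ * max (R n c s₀) 0 ^ 2 + t / 2 := by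
      have h3 : (2 * t)⁻¹ * max (R n c s₀) 0 ^ 2 + t / 2 - max (R n c s₀) 0 =
          (2 * t)⁻¹ * (max (R n c s₀) 0 - t) ^ 2 := by
        field_simp
        ring
      have h4 : 0 ≤ (2 * t)⁻¹ * (max (R n c s₀) 0 - t) ^ 2 := by positivity
      linarith
    have h5 : (2 * t)⁻¹ * max (R n c s₀) 0 ^ 2 ≤ (2 * t)⁻¹ * ∑ s, max (R n c s) 0 ^ 2 :=
      mul_le_mul_of_nonneg_left h1 (by positivity)
    linarith [le_max_left (R n c s₀) 0]
  have hRn : k.expect (fun c => R n c s₀) ≤ t := by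
    have h1 := k.expect_mono hpoint
    rw [k.expect_add, k.expect_const, k.expect_const_mul] at h1
    have h2 : (2 * t)⁻¹ * k.expect (fun c => ∑ s, max (R n c s) 0 ^ 2) ≤ (2 * t)⁻¹ * (t * t) :=
      mul_le_mul_of_nonneg_left (by rw [htt]; exact hΦ) (by positivity)
    have h3 : (2 * t)⁻¹ * (t * t) = t / 2 := by field_simp
    linarith
  have hpay : statePay g α β s₀ = y s₀ + (-(n : ℝ)⁻¹) * k.expect (fun c => R n c s₀) := by
    rw [statePay, ← hk, ← k.expect_const_mul]
    nth_rewrite 1 [← k.expect_const (y s₀)]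
    rw [← k.expect_add]
    congr 1
    funext c
    simp only [avgPay, R, d, Fin.is_lt, Finset.filter_true, Finset.sum_sub_distrib,
      Finset.sum_const, Finset.card_univ, Fintype.card_fin, nsmul_eq_mul]
    field_simp
    ring
  have htn : (n : ℝ)⁻¹ * t = Real.sqrt K / Real.sqrt n := by
    rw [ht, Real.sqrt_mul hn'.le]
    have h1 : Real.sqrt n * Real.sqrt n = n := Real.mul_self_sqrt hn'.le
    have h2 : 0 < Real.sqrt n := Real.sqrt_pos.2 hn'
    nth_rewrite 1 [← h1]
    field_simp
  have hfin := mul_le_mul_of_nonneg_left hRn (inv_nonneg.2 hn'.le)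
  rw [hpay]
  linarith

/-! ### Supporting hyperplanes of a greatest convex minorant -/

theorem isCompact_convexHull_of_finiteDimensional {E : Type*} [NormedAddCommGroup E]
    [NormedSpace ℝ E] [FiniteDimensional ℝ E] {K : Set E} (hK : IsCompact K) :
    IsCompact (convexHull ℝ K) := by
  classical
  rcases K.eq_empty_or_nonempty with rfl | ⟨x₀, hx₀⟩
  · simp
  let N := Module.finrank ℝ E + 1
  have himage : convexHull ℝ K = (fun p : (Fin N → E) × (Fin N → ℝ) => ∑ i, p.2 i • p.1 i) ''
      ((Set.univ.pi fun _ => K) ×ˢ stdSimplex ℝ (Fin N)) := by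
    refine Set.Subset.antisymm (fun x hx => ?_) ?_
    · obtain ⟨ι, _, z, v, hz, hind, hv, hv1, rfl⟩ := eq_pos_convex_span_of_mem_convexHull hx
      have hcard : Fintype.card ι ≤ Fintype.card (Fin N) := by
        rw [Fintype.card_fin]
        exact hind.card_le_finrank_succ.trans (Nat.succ_le_succ (Submodule.finrank_le _))
      obtain ⟨e⟩ := Function.Embedding.nonempty_of_card_le hcard
      have hout : ∀ j ∉ Set.range e, Function.extend e v 0 j = 0 := fun j hj => by
        rw [Function.extend_apply' _ _ _ hj, Pi.zero_apply]
      refine ⟨(Function.extend e z fun _ => x₀, Function.extend e v 0),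
        ⟨fun j _ => ?_, ?_, ?_⟩, ?_⟩
      · change Function.extend e z (fun _ => x₀) j ∈ K
        by_cases hj : ∃ i, e i = j
        · obtain ⟨i, rfl⟩ := hj
          rw [e.injective.extend_apply]
          exact hz (Set.mem_range_self i)
        · rwa [Function.extend_apply' _ _ _ hj]
      · intro j
        by_cases hj : ∃ i, e i = j
        · obtain ⟨i, rfl⟩ := hj
          simpa only [e.injective.extend_apply] using (hv i).le
        · exact (hout j hj).ge
      · rw [← hv1]
        exact (Fintype.sum_of_injective e e.injective _ _ hout fun i => by
          simp only [e.injective.extend_apply]).symm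
      · refine (Fintype.sum_of_injective e e.injective _ _ (fun j hj => ?_) fun i => ?_).symm
        · simp only [hout j hj, zero_smul]
        · simp only [e.injective.extend_apply]
    · rintro _ ⟨⟨z, v⟩, ⟨hz, hv⟩, rfl⟩
      exact (convex_convexHull ℝ K).sum_mem (fun i _ => hv.1 i) hv.2
        fun i _ => subset_convexHull ℝ K (hz i trivial)
  rw [himage]
  exact ((isCompact_univ_pi fun _ => hK).prod (isCompact_stdSimplex ℝ (Fin N))).image (by fun_prop)

/-- A linear function strictly below `u` on the simplex that nearly touches a convex minorant. -/
theorem exists_linear_lt_of_convexOn {S : Type*} [Fintype S] {u w : (S → ℝ) → ℝ}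
    (hu : ContinuousOn u (stdSimplex ℝ S)) (hw : ConvexOn ℝ (stdSimplex ℝ S) w)
    (hle : ∀ p ∈ stdSimplex ℝ S, w p ≤ u p) {q : S → ℝ} (hq : q ∈ stdSimplex ℝ S) {ε : ℝ}
    (hε : 0 < ε) :
    ∃ y : S → ℝ, (∀ p ∈ stdSimplex ℝ S, ∑ s, p s * y s < u p) ∧ w q - ε < ∑ s, q s * y s := by
  classical
  have hcompact : IsCompact (convexHull ℝ ((fun p => (p, u p)) '' stdSimplex ℝ S)) :=
    isCompact_convexHull_of_finiteDimensional
      ((isCompact_stdSimplex ℝ S).image_of_continuousOn (continuousOn_id.prodMk hu))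
  have hnot : (q, w q - ε) ∉ convexHull ℝ ((fun p => (p, u p)) '' stdSimplex ℝ S) :=
    fun hmem => by
    have hsub : convexHull ℝ ((fun p => (p, u p)) '' stdSimplex ℝ S) ⊆
        {p : (S → ℝ) × ℝ | p.1 ∈ stdSimplex ℝ S ∧ w p.1 ≤ p.2} := by
      refine convexHull_min ?_ hw.convex_epigraph
      rintro _ ⟨p, hp, rfl⟩
      exact ⟨hp, hle p hp⟩
    have := (hsub hmem).2
    simp only at this
    linarith
  obtain ⟨f, r, hfq, hf⟩ := geometric_hahn_banach_point_closed (convex_convexHull ℝ _)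
    hcompact.isClosed hnot
  have hgraph : ∀ p ∈ stdSimplex ℝ S, r < f (p, u p) := fun p hp =>
    hf _ (subset_convexHull ℝ _ ⟨p, hp, rfl⟩)
  have hsplit : ∀ p ∈ stdSimplex ℝ S, ∀ t : ℝ,
      f (p, t) - r = ∑ s, p s * (f (Pi.single s 1, 0) - r) + t * f (0, 1) := fun p hp t => by
    have h1 : (p, t) = ∑ s, p s • ((Pi.single s 1 : S → ℝ), (0 : ℝ)) +
        t • ((0 : S → ℝ), (1 : ℝ)) := by
      ext s
      · simp [Prod.fst_sum, Finset.sum_apply, Pi.single_apply]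
      · simp [Prod.snd_sum]
    rw [h1]
    simp only [map_add, map_sum, map_smul, smul_eq_mul, mul_sub, Finset.sum_sub_distrib,
      ← Finset.sum_mul, hp.2]
    ring
  have hpos : 0 < f (0, 1) := by
    have h1 := hsplit q hq (w q - ε)
    have h2 := hsplit q hq (u q)
    have h3 := hgraph q hq
    have h4 : 0 < (u q - (w q - ε)) * f (0, 1) := by linarith
    exact (pos_iff_pos_of_mul_pos h4).1 (by linarith [hle q hq])
  have hy : ∀ p : S → ℝ, ∑ s, p s * (-(f (Pi.single s 1, 0) - r) / f (0, 1)) =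
      -(∑ s, p s * (f (Pi.single s 1, 0) - r)) / f (0, 1) := fun p => by
    rw [neg_div, Finset.sum_div, ← Finset.sum_neg_distrib]
    exact Finset.sum_congr rfl fun s _ => by ring
  refine ⟨fun s => -(f (Pi.single s 1, 0) - r) / f (0, 1), fun p hp => ?_, ?_⟩
  · rw [hy, div_lt_iff₀ hpos]
    linarith [hsplit p hp (u p), hgraph p hp]
  · rw [hy, lt_div_iff₀ hpos]
    linarith [hsplit q hq (w q - ε)]

/-- A linear minorant of `u`, truncated from below at a lower bound of the payoffs, satisfies
Blackwell's condition. -/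
theorem blackwell_of_linear_lt_uVal [Nonempty A] [Nonempty B] {g : S → A → B → ℝ} {M : ℝ}
    (hM : ∀ s a b, |g s a b| ≤ M) {y : S → ℝ}
    (hy : ∀ p ∈ stdSimplex ℝ S, ∑ s, p s * y s < uVal g p) (v : S → ℝ) :
    ∃ x : A → ℝ, (∀ a, 0 ≤ x a) ∧ ∑ a, x a = 1 ∧
      ∀ b, ∑ s, ∑ a, max (v s) 0 * x a * (max (y s) (-M) - g s a b) ≤ 0 := by
  classical
  have := nonempty_mixed (A := A)
  let z : S → ℝ := fun s => if -M ≤ y s then max (v s) 0 else 0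
  have hz0 : ∀ s, 0 ≤ z s := fun s => by
    simp only [z]
    split_ifs
    · exact le_max_right _ _
    · exact le_rfl
  have hterm : ∀ x : A → ℝ, (∀ a, 0 ≤ x a) → ∀ s a b,
      max (v s) 0 * x a * (max (y s) (-M) - g s a b) ≤ z s * x a * (y s - g s a b) := by
    intro x hx s a b
    simp only [z]
    split_ifs with h
    · rw [max_eq_left h]
    · rw [max_eq_right (not_le.1 h).le, zero_mul, zero_mul]
      exact mul_nonpos_of_nonneg_of_nonpos (mul_nonneg (le_max_right _ _) (hx a))
        (by linarith [(abs_le.1 (hM s a b)).1])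
  suffices h : ∃ x : A → ℝ, (∀ a, 0 ≤ x a) ∧ ∑ a, x a = 1 ∧
      ∀ b, ∑ s, ∑ a, z s * x a * (y s - g s a b) ≤ 0 by
    obtain ⟨x, hx0, hx1, hx⟩ := h
    exact ⟨x, hx0, hx1, fun b => (Finset.sum_le_sum fun s _ => Finset.sum_le_sum fun a _ =>
      hterm x hx0 s a b).trans (hx b)⟩
  rcases (Finset.sum_nonneg fun s _ => hz0 s).eq_or_lt with hsum | hsum
  · have hz : ∀ s, z s = 0 := fun s =>
      (Finset.sum_eq_zero_iff_of_nonneg fun s _ => hz0 s).1 hsum.symm s (Finset.mem_univ s)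
    obtain ⟨x⟩ := this
    exact ⟨x.1, x.2.1, x.2.2, fun b => by simp [hz]⟩
  · set Z := ∑ s, z s with hZ
    have hp : (fun s => Z⁻¹ * z s) ∈ stdSimplex ℝ S :=
      ⟨fun s => mul_nonneg (inv_nonneg.2 hsum.le) (hz0 s), by
        rw [← Finset.mul_sum, ← hZ, inv_mul_cancel₀ hsum.ne']⟩
    obtain ⟨x, hx⟩ := exists_lt_of_lt_ciSup (hy _ hp)
    refine ⟨x.1, x.2.1, x.2.2, fun b => ?_⟩
    have h1 : ∑ s, Z⁻¹ * z s * y s ≤ mixedPay g (fun s => Z⁻¹ * z s) x.1 b :=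
      hx.le.trans (ciInf_le (Set.finite_range _).bddBelow b)
    have h2 : ∑ s, ∑ a, z s * x.1 a * (y s - g s a b) =
        Z * (∑ s, Z⁻¹ * z s * y s - mixedPay g (fun s => Z⁻¹ * z s) x.1 b) := by
      rw [mixedPay, ← Finset.sum_sub_distrib, Finset.mul_sum]
      refine Finset.sum_congr rfl fun s _ => ?_
      have h3 : Z⁻¹ * z s * y s = ∑ a, Z⁻¹ * z s * x.1 a * y s := by
        rw [← Finset.sum_mul, ← Finset.mul_sum, x.2.2, mul_one]
      rw [h3, ← Finset.sum_sub_distrib, Finset.mul_sum]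
      refine Finset.sum_congr rfl fun a _ => ?_
      field_simp
    rw [h2]
    exact mul_nonpos_of_nonneg_of_nonpos hsum.le (by linarith)

/-- (Mertens–Zamir / Zamir, Theorem 3.16, restated.) There is a constant
`C > 0` such that for every prior `q` on `𝒮` and every `n ≥ 1`,
`0 ≤ (vex u)(q) − V_n(q) ≤ C / √n`, where `vex u = w` is the greatest convex minorant of `u`
on the probability simplex. -/
theorem stmt16 {S A B : Type*} [Fintype S] [Fintype A] [Fintype B]
    [Nonempty S] [Nonempty A] [Nonempty B]
    (g : S → A → B → ℝ)
    (w : (S → ℝ) → ℝ)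
    (hconv : ConvexOn ℝ (stdSimplex ℝ S) w)
    (hle : ∀ q ∈ stdSimplex ℝ S, w q ≤ uVal g q)
    (hgreatest : ∀ h : (S → ℝ) → ℝ, ConvexOn ℝ (stdSimplex ℝ S) h →
      (∀ q ∈ stdSimplex ℝ S, h q ≤ uVal g q) → ∀ q ∈ stdSimplex ℝ S, h q ≤ w q) :
    ∃ C : ℝ, 0 < C ∧ ∀ q ∈ stdSimplex ℝ S, ∀ n : ℕ, 1 ≤ n →
      0 ≤ w q - Vn g q n ∧ w q - Vn g q n ≤ C / Real.sqrt n := by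
  classical
  obtain ⟨M, hMpos, hM⟩ : ∃ M : ℝ, 0 < M ∧ ∀ s a b, |g s a b| ≤ M := by
    refine ⟨∑ s, ∑ a, ∑ b, |g s a b| + 1, by positivity, fun s a b => ?_⟩
    have h1 : |g s a b| ≤ ∑ b, |g s a b| :=
      Finset.single_le_sum (f := fun b => |g s a b|) (fun _ _ => abs_nonneg _) (Finset.mem_univ b)
    have h2 : ∑ b, |g s a b| ≤ ∑ a, ∑ b, |g s a b| :=
      Finset.single_le_sum (f := fun a => ∑ b, |g s a b|)
        (fun _ _ => Finset.sum_nonneg fun _ _ => abs_nonneg _) (Finset.mem_univ a)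
    have h3 : ∑ a, ∑ b, |g s a b| ≤ ∑ s, ∑ a, ∑ b, |g s a b| :=
      Finset.single_le_sum (f := fun s => ∑ a, ∑ b, |g s a b|)
        (fun _ _ => Finset.sum_nonneg fun _ _ => Finset.sum_nonneg fun _ _ => abs_nonneg _)
        (Finset.mem_univ s)
    linarith
  refine ⟨Real.sqrt (Fintype.card S * (4 * M ^ 2)), by positivity, fun q hq n hn => ⟨?_, ?_⟩⟩
  · exact sub_nonneg.2 (hgreatest (fun p => Vn g p n) (convexOn_Vn g hM hn)
      (fun p hp => Vn_le_uVal hM hp hn) q hq)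
  set D := Real.sqrt (Fintype.card S * (4 * M ^ 2)) / Real.sqrt n
  refine le_of_forall_pos_lt_add fun ε hε => ?_
  obtain ⟨y, hyu, hyw⟩ := exists_linear_lt_of_convexOn (continuous_uVal g hM).continuousOn hconv
    hle hq hε
  have hyM : ∀ s, y s ≤ M := fun s => by
    have hs := single_mem_stdSimplex ℝ s
    have := (hyu _ hs).le.trans (uVal_le hM hs)
    simpa [Pi.single_apply] using this
  obtain ⟨α, hα⟩ := exists_strategy_le_statePay hMpos hM (y := fun s => max (y s) (-M))
    (fun s => abs_le.2 ⟨le_max_right _ _, max_le (hyM s) (by linarith)⟩)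
    (blackwell_of_linear_lt_uVal hM hyu) hn
  have hguar : ∑ s, q s * y s - D ≤ Vn g q n := by
    refine le_trans (le_ciInf fun β => ?_) (le_ciSup (bddAbove_iInf_expPay hM hq hn) α)
    rw [expPay_eq_sum_statePay]
    calc ∑ s, q s * y s - D = ∑ s, q s * (y s - D) := by
          simp only [mul_sub, Finset.sum_sub_distrib, ← Finset.sum_mul, hq.2, one_mul]
      _ ≤ ∑ s, q s * statePay g α β s := Finset.sum_le_sum fun s _ =>
          mul_le_mul_of_nonneg_left
            ((sub_le_sub_right (le_max_left _ _) _).trans (hα β s)) (hq.1 s)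
  linarith
end
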